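/- Bouc-Wen oscillator of class I: let m, k, D > 0, α ∈ (0, 1), n > 1, A > 0, β, γ ∈ ℝ with γ ∈ (−β, β], and b ≥ 0. Then for every triple of differentiable functions x, z, v : [0, +∞) → ℝ satisfying x'(t) = v(t), z'(t) = D⁻¹A v(t) − D⁻¹β|z(t)|^{n−1} z(t) |v(t)| − D⁻¹γ|z(t)|ⁿ v(t), v'(t) = −α(k/m)x(t) − (1−α)D(k/m)z(t) − (b/m)v(t) for all t ≥ 0, there exist x_∞, z_∞ ∈ ℝ such that x(t) → x_∞, z(t) → z_∞, and v(t) → 0 as t → +∞, and moreover α x_∞ + (1−α) D z_∞ = 0. -/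

import Mathlib

open Filter Set Topology

/-- Limits of time translates along an ultrafilter: a solution of an autonomous differential
equation that stays in a compact set for `t ≥ 0` has a complete limit solution along every
ultrafilter at infinity. -/
theorem exists_hasDerivAt_ultrafilter_limit {E : Type*} [NormedAddCommGroup E] [NormedSpace ℝ E]
    {F : E → E} {y : ℝ → E} {K : Set E} (hK : IsCompact K) (hF : ContinuousOn F K)
    (hyK : ∀ t ∈ Ici (0 : ℝ), y t ∈ K)
    (hy : ∀ t ∈ Ici (0 : ℝ), HasDerivWithinAt y (F (y t)) (Ici 0) t)
    (U : Ultrafilter ℝ) (hU : (U : Filter ℝ) ≤ atTop) :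
    ∃ Y : ℝ → E, (∀ s, Y s ∈ K ∧ Tendsto (fun t => y (t + s)) U (𝓝 (Y s))) ∧
      ∀ s, HasDerivAt Y (F (Y s)) s := by
  have hnonneg : ∀ s : ℝ, ∀ᶠ t in (U : Filter ℝ), 0 ≤ t + s := fun s =>
    hU ((eventually_ge_atTop (-s)).mono fun t ht => by linarith)
  have hlim : ∀ s : ℝ, ∃ p, p ∈ K ∧ Tendsto (fun t => y (t + s)) U (𝓝 p) := by
    intro s
    obtain ⟨p, hp, hle⟩ := hK.ultrafilter_le_nhds (U.map fun t => y (t + s))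
      (le_principal_iff.2 ((hnonneg s).mono fun t ht => hyK _ ht))
    exact ⟨p, hp, hle⟩
  choose Y hY using hlim
  refine ⟨Y, hY, fun s => ?_⟩
  obtain ⟨M, hM⟩ := hK.exists_bound_of_continuousOn hF
  have hM0 : 0 ≤ M := (norm_nonneg _).trans (hM _ (hY s).1)
  have hFY : Tendsto (fun t => F (y (t + s))) U (𝓝 (F (Y s))) :=
    ((hF _ (hY s).1).tendsto).comp
      (tendsto_nhdsWithin_iff.2 ⟨(hY s).2, (hnonneg s).mono fun t ht => hyK _ ht⟩)
  have hLip : ∀ t₁ ∈ Ici (0 : ℝ), ∀ t₂ ∈ Ici (0 : ℝ), ‖y t₂ - y t₁‖ ≤ M * ‖t₂ - t₁‖ :=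
    fun t₁ h₁ t₂ h₂ => (convex_Ici 0).norm_image_sub_le_of_norm_hasDerivWithin_le hy
      (fun t ht => hM _ (hyK t ht)) h₁ h₂
  rw [hasDerivAt_iff_isLittleO, Asymptotics.isLittleO_iff]
  intro ε hε
  obtain ⟨δ, hδ, hFδ⟩ :=
    Metric.uniformContinuousOn_iff_le.1 (hK.uniformContinuousOn_of_continuous hF) ε hε
  filter_upwards [Metric.ball_mem_nhds s (show 0 < δ / (M + 1) by positivity)] with r hr
  have hrs : |r - s| * (M + 1) < δ := by
    rw [Metric.mem_ball, Real.dist_eq] at hr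
    exact (lt_div_iff₀ (by positivity)).1 hr
  refine le_of_tendsto ((((hY r).2.sub (hY s).2).sub (hFY.const_smul (r - s))).norm) ?_
  filter_upwards [hnonneg r, hnonneg s] with t htr hts
  have hsub : uIcc (t + s) (t + r) ⊆ Ici 0 := fun τ hτ => (le_min hts htr).trans hτ.1
  have key := (convex_uIcc (t + s) (t + r)).norm_image_sub_le_of_norm_hasDerivWithin_le
    (f := fun τ => y τ - τ • F (y (t + s))) (f' := fun τ => F (y τ) - F (y (t + s))) (C := ε)
    (fun τ hτ => ?_) (fun τ hτ => ?_) left_mem_uIcc right_mem_uIcc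
  · have e₁ : y (t + r) - y (t + s) - (r - s) • F (y (t + s)) =
        y (t + r) - (t + r) • F (y (t + s)) - (y (t + s) - (t + s) • F (y (t + s))) := by
      module
    rwa [e₁, ← add_sub_add_left_eq_sub r s t]
  · simpa [Pi.sub_def] using ((hy τ (hsub hτ)).mono hsub).sub
      ((hasDerivWithinAt_id τ _).smul_const (F (y (t + s))))
  · rw [← dist_eq_norm]
    refine hFδ _ (hyK _ (hsub hτ)) _ (hyK _ hts) ?_
    rw [dist_eq_norm]
    have h1 := hLip _ hts _ (hsub hτ)
    have h2 : |τ - (t + s)| ≤ |r - s| := by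
      simpa using abs_sub_left_of_mem_uIcc hτ
    rw [Real.norm_eq_abs] at h1
    nlinarith [abs_nonneg (r - s)]

/-- Solutions of the harmonic oscillator are trigonometric. -/
theorem eq_cos_sin_of_hasDerivAt {ω : ℝ} {u v : ℝ → ℝ}
    (hu : ∀ s, HasDerivAt u (ω * v s) s) (hv : ∀ s, HasDerivAt v (-(ω * u s)) s) (s : ℝ) :
    v s = v 0 * Real.cos (ω * s) - u 0 * Real.sin (ω * s) ∧
      u s = v 0 * Real.sin (ω * s) + u 0 * Real.cos (ω * s) := by
  have hω : ∀ s, HasDerivAt (fun s => ω * s) ω s := fun s => by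
    simpa using (hasDerivAt_id s).const_mul ω
  have hP : ∀ s, HasDerivAt
      (fun s => v s * Real.cos (ω * s) + u s * Real.sin (ω * s)) 0 s := fun s => by
    exact (((hv s).mul (hω s).cos).add ((hu s).mul (hω s).sin)).congr_deriv (by ring)
  have hQ : ∀ s, HasDerivAt
      (fun s => u s * Real.cos (ω * s) - v s * Real.sin (ω * s)) 0 s := fun s => by
    exact (((hu s).mul (hω s).cos).sub ((hv s).mul (hω s).sin)).congr_deriv (by ring)
  have eP := is_const_of_deriv_eq_zero (fun s => (hP s).differentiableAt)
    (fun s => (hP s).deriv) s 0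
  have eQ := is_const_of_deriv_eq_zero (fun s => (hQ s).differentiableAt)
    (fun s => (hQ s).deriv) s 0
  simp only [mul_zero, Real.cos_zero, Real.sin_zero, mul_one, add_zero, sub_zero] at eP eQ
  have h1 := Real.sin_sq_add_cos_sq (ω * s)
  constructor
  · rw [← eP, ← eQ]; linear_combination (-v s) * h1
  · rw [← eP, ← eQ]; linear_combination (-u s) * h1

/-- A harmonic oscillation on which an affine function of the position never has the sign of the
velocity is at rest. -/
theorem harmonic_eq_zero_of_affine_mul_nonpos {ω c q : ℝ} {u v : ℝ → ℝ} (hω : 0 < ω) (hq : 0 < q)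
    (hu : ∀ s, HasDerivAt u (ω * v s) s) (hv : ∀ s, HasDerivAt v (-(ω * u s)) s)
    (hle : ∀ s, (c + q * u s) * v s ≤ 0) : u 0 = 0 ∧ v 0 = 0 := by
  have hshift : ∀ r s, v (s + r) =
      v r * Real.cos (ω * s) - u r * Real.sin (ω * s) ∧
      u (s + r) = v r * Real.sin (ω * s) + u r * Real.cos (ω * s) := fun r s => by
    simpa using eq_cos_sin_of_hasDerivAt (u := fun s => u (s + r)) (v := fun s => v (s + r))
      (fun s => (hu (s + r)).comp_add_const s r) (fun s => (hv (s + r)).comp_add_const s r) s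
  have e1 : ω * (Real.pi / ω) = Real.pi := by field_simp
  have e2 : ω * (Real.pi / 2 / ω) = Real.pi / 2 := by field_simp
  have hnonpos : ∀ r, u r * v r ≤ 0 := fun r => by
    obtain ⟨h1, h2⟩ := hshift r (Real.pi / ω)
    rw [e1] at h1 h2
    simp only [Real.cos_pi, Real.sin_pi] at h1 h2
    have h3 := hle (Real.pi / ω + r)
    rw [h1, h2] at h3
    have h4 := hle r
    have : q * (u r * v r) ≤ 0 := by nlinarith
    exact nonpos_of_mul_nonpos_right this hq
  have hzero : ∀ r, u r * v r = 0 := fun r => by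
    obtain ⟨h1, h2⟩ := hshift r (Real.pi / 2 / ω)
    rw [e2] at h1 h2
    simp only [Real.cos_pi_div_two, Real.sin_pi_div_two] at h1 h2
    have h3 := hnonpos (Real.pi / 2 / ω + r)
    rw [h1, h2] at h3
    have h4 := hnonpos r
    nlinarith
  have hd := ((hu 0).mul (hv 0)).unique
    (((hasDerivAt_const (0 : ℝ) (0 : ℝ))).congr_of_eventuallyEq (.of_forall hzero))
  have hsq : v 0 ^ 2 = u 0 ^ 2 := by
    have : ω * (v 0 ^ 2 - u 0 ^ 2) = 0 := by linear_combination hd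
    rcases mul_eq_zero.1 this with h | h <;> linarith
  rcases mul_eq_zero.1 (hzero 0) with h | h
  · exact ⟨h, by simpa [h] using hsq⟩
  · exact ⟨by simpa [h] using hsq.symm, h⟩

/-- A continuous real function whose square converges at infinity converges. -/
theorem exists_tendsto_of_tendsto_sq {f : ℝ → ℝ} {l : ℝ} (hf : ContinuousOn f (Ici 0))
    (h : Tendsto (fun t => f t ^ 2) atTop (𝓝 l)) : ∃ a, Tendsto f atTop (𝓝 a) := by
  have hs : Tendsto (fun t => |f t|) atTop (𝓝 √l) := by
    simpa [Real.sqrt_sq_eq_abs] using h.sqrt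
  rcases (Real.sqrt_nonneg l).eq_or_lt with h0 | h0
  · exact ⟨0, tendsto_zero_iff_abs_tendsto_zero _ |>.2 (h0 ▸ hs)⟩
  obtain ⟨T, hT⟩ := eventually_atTop.1
    ((hs.eventually (lt_mem_nhds h0)).and (eventually_ge_atTop (0 : ℝ)))
  have hT0 : 0 ≤ T := (hT T le_rfl).2
  have hne : ∀ t ∈ Ici T, f t ≠ 0 := fun t ht => abs_pos.1 (hT t ht).1
  have hc : ContinuousOn f (Ici T) := hf.mono (Ici_subset_Ici.2 hT0)
  by_cases hpos : 0 < f T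
  · refine ⟨√l, hs.congr' ?_⟩
    filter_upwards [eventually_ge_atTop T] with t ht
    refine abs_of_nonneg (not_lt.1 fun hneg => ?_)
    obtain ⟨r, hr, hr0⟩ := isPreconnected_Ici.intermediate_value (show t ∈ Ici T from ht)
      self_mem_Ici hc ⟨hneg.le, hpos.le⟩
    exact hne r hr hr0
  · refine ⟨-√l, hs.neg.congr' ?_⟩
    filter_upwards [eventually_ge_atTop T] with t ht
    have : f t ≤ 0 := not_lt.1 fun hpos' => by
      obtain ⟨r, hr, hr0⟩ := isPreconnected_Ici.intermediate_value (self_mem_Ici (a := T))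
        (show t ∈ Ici T from ht) hc ⟨not_lt.1 hpos, hpos'.le⟩
      exact hne r hr hr0
    rw [abs_of_nonpos this, neg_neg]

theorem mul_hysteresis_eq (β γ : ℝ) {n : ℝ} (hn : 1 < n) (z v : ℝ) :
    z * (β * |z| ^ (n - 1) * z * |v| + γ * |z| ^ n * v) =
      |z| ^ n * (β * |z * v| + γ * (z * v)) := by
  have h1 : |z| ^ n = |z| ^ (n - 1) * |z| := by
    rw [← Real.rpow_add_one' (abs_nonneg z) (by linarith), sub_add_cancel]
  rw [h1, abs_mul]
  linear_combination (-(β * |z| ^ (n - 1) * |v|)) * abs_mul_abs_self z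

theorem mul_abs_add_mul_nonneg {β γ : ℝ} (hγ : γ ∈ Ioc (-β) β) (r : ℝ) :
    0 ≤ β * |r| + γ * r := by
  obtain ⟨h1, h2⟩ := hγ
  rcases abs_cases r with ⟨h, hr⟩ | ⟨h, hr⟩ <;> rw [h] <;> nlinarith

theorem mul_hysteresis_nonneg {β γ n : ℝ} (hγ : γ ∈ Ioc (-β) β) (hn : 1 < n) (z v : ℝ) :
    0 ≤ z * (β * |z| ^ (n - 1) * z * |v| + γ * |z| ^ n * v) := by
  rw [mul_hysteresis_eq β γ hn]
  exact mul_nonneg (by positivity) (mul_abs_add_mul_nonneg hγ _)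

/-- Where the hysteresis dissipates no energy, its nonlinear part vanishes and `z` and `v` do not
have the same strict sign. -/
theorem hysteresis_eq_zero_and_mul_nonpos {β γ n z v : ℝ} (hγ : γ ∈ Ioc (-β) β) (hn : 1 < n)
    (h : z * (β * |z| ^ (n - 1) * z * |v| + γ * |z| ^ n * v) = 0) :
    β * |z| ^ (n - 1) * z * |v| + γ * |z| ^ n * v = 0 ∧ z * v ≤ 0 := by
  rcases eq_or_ne z 0 with rfl | hz
  · simp [Real.zero_rpow (by linarith : n ≠ 0)]
  refine ⟨(mul_eq_zero.1 h).resolve_left hz, not_lt.1 fun hpos => ?_⟩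
  rw [mul_hysteresis_eq β γ hn, abs_of_pos hpos, ← add_mul] at h
  have : 0 < |z| ^ n := by positivity
  have : 0 < β + γ := by linarith [hγ.1]
  exact h.not_gt (by positivity)

/-- A complete solution of the Bouc-Wen oscillator of class I on which the energy is not
dissipated is at equilibrium. -/
theorem boucWen_eq_zero_of_no_dissipation {m k D A β γ b n α : ℝ}
    (hm : 0 < m) (hk : 0 < k) (hD : 0 < D) (hα : α ∈ Ioo (0 : ℝ) 1) (hn : 1 < n)
    (hA : 0 < A) (hγ : γ ∈ Ioc (-β) β) {x z v : ℝ → ℝ}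
    (hx : ∀ t, HasDerivAt x (v t) t)
    (hz : ∀ t, HasDerivAt z (D⁻¹ * A * v t - D⁻¹ * β * |z t| ^ (n - 1) * z t * |v t| -
        D⁻¹ * γ * |z t| ^ n * v t) t)
    (hv : ∀ t, HasDerivAt v
      (-(α * (k / m) * x t) - (1 - α) * D * (k / m) * z t - (b / m) * v t) t)
    (hb : ∀ t, b * v t = 0)
    (hh : ∀ t, z t * (β * |z t| ^ (n - 1) * z t * |v t| + γ * |z t| ^ n * v t) = 0) :
    α * x 0 + (1 - α) * D * z 0 = 0 ∧ v 0 = 0 := by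
  obtain ⟨hα0, hα1⟩ := hα
  have hz' : ∀ t, HasDerivAt z (D⁻¹ * A * v t) t := fun t =>
    (hz t).congr_deriv (by
      linear_combination (-D⁻¹) * (hysteresis_eq_zero_and_mul_nonpos hγ hn (hh t)).1)
  set a := α + (1 - α) * A with ha
  have ha0 : 0 < a := by nlinarith
  set ω := √(k * a / m) with hω
  have hω0 : 0 < ω := Real.sqrt_pos.2 (by positivity)
  have hω2 : ω ^ 2 = k * a / m := Real.sq_sqrt (by positivity)
  set u : ℝ → ℝ := fun t => ω / a * (α * x t + (1 - α) * D * z t) with hu_def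
  have hu : ∀ t, HasDerivAt u (ω * v t) t := fun t =>
    ((((hx t).const_mul α).add ((hz' t).const_mul ((1 - α) * D))).const_mul (ω / a)).congr_deriv
      (by field_simp; rw [ha]; ring)
  have hv' : ∀ t, HasDerivAt v (-(ω * u t)) t := fun t => (hv t).congr_deriv (by
    have h1 : ω * u t = k / m * (α * x t + (1 - α) * D * z t) := by
      have : ω * u t = ω ^ 2 / a * (α * x t + (1 - α) * D * z t) := by rw [hu_def]; ring
      rw [this, hω2]; field_simp
    rw [h1]; linear_combination (-1 / m) * hb t)
  have hq : 0 < D⁻¹ * A / ω := by positivity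
  have hconst : ∀ t, z t = (z 0 - D⁻¹ * A / ω * u 0) + D⁻¹ * A / ω * u t := fun t => by
    have hd : ∀ t, HasDerivAt (fun t => z t - D⁻¹ * A / ω * u t) 0 t := fun t =>
      ((hz' t).sub ((hu t).const_mul (D⁻¹ * A / ω))).congr_deriv (by field_simp; ring)
    have := is_const_of_deriv_eq_zero (fun t => (hd t).differentiableAt)
      (fun t => (hd t).deriv) t 0
    linear_combination this
  obtain ⟨hu0, hv0⟩ := harmonic_eq_zero_of_affine_mul_nonpos hω0 hq hu hv' fun t => by
    rw [← hconst t]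
    exact (hysteresis_eq_zero_and_mul_nonpos hγ hn (hh t)).2
  exact ⟨(mul_eq_zero.1 hu0).resolve_left (by positivity), hv0⟩

/-- The energy balance of the Bouc-Wen oscillator. -/
theorem boucWen_hasDerivWithinAt_energy {m k D A β γ b n α : ℝ} (hm : 0 < m)
    (hA : 0 < A) {x z v : ℝ → ℝ} {S : Set ℝ} {t : ℝ}
    (hx : HasDerivWithinAt x (v t) S t)
    (hz : HasDerivWithinAt z (D⁻¹ * A * v t - D⁻¹ * β * |z t| ^ (n - 1) * z t * |v t| -
        D⁻¹ * γ * |z t| ^ n * v t) S t)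
    (hv : HasDerivWithinAt v
      (-(α * (k / m) * x t) - (1 - α) * D * (k / m) * z t - (b / m) * v t) S t) :
    HasDerivWithinAt
      (fun t => m / 2 * v t ^ 2 + α * k / 2 * x t ^ 2 +
        (1 - α) * D ^ 2 * k / (2 * A) * z t ^ 2)
      (-(b * v t ^ 2 + (1 - α) * D * k / A *
        (z t * (β * |z t| ^ (n - 1) * z t * |v t| + γ * |z t| ^ n * v t)))) S t := by
  refine (((((hv.pow 2).const_mul (m / 2)).add ((hx.pow 2).const_mul (α * k / 2))).add
    ((hz.pow 2).const_mul ((1 - α) * D ^ 2 * k / (2 * A))))).congr_deriv ?_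
  field_simp
  ring

/-- The velocity and the restoring force tend to zero along solutions of the Bouc-Wen
oscillator of class I. -/
theorem boucWen_tendsto_of_energy {m k D A β γ b n α L R : ℝ}
    (hm : 0 < m) (hk : 0 < k) (hD : 0 < D) (hα : α ∈ Ioo (0 : ℝ) 1) (hn : 1 < n)
    (hA : 0 < A) (hγ : γ ∈ Ioc (-β) β) (hb : 0 ≤ b) {x z v : ℝ → ℝ}
    (hx : ∀ t ∈ Ici (0 : ℝ), HasDerivWithinAt x (v t) (Ici 0) t)
    (hz : ∀ t ∈ Ici (0 : ℝ), HasDerivWithinAt z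
      (D⁻¹ * A * v t - D⁻¹ * β * |z t| ^ (n - 1) * z t * |v t| -
        D⁻¹ * γ * |z t| ^ n * v t) (Ici 0) t)
    (hv : ∀ t ∈ Ici (0 : ℝ), HasDerivWithinAt v
      (-(α * (k / m) * x t) - (1 - α) * D * (k / m) * z t - (b / m) * v t) (Ici 0) t)
    (hR : ∀ t ∈ Ici (0 : ℝ), |x t| ≤ R ∧ |z t| ≤ R ∧ |v t| ≤ R)
    (hL : Tendsto (fun t => m / 2 * v t ^ 2 + α * k / 2 * x t ^ 2 +
        (1 - α) * D ^ 2 * k / (2 * A) * z t ^ 2) atTop (𝓝 L)) :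
    Tendsto (fun t => α * x t + (1 - α) * D * z t) atTop (𝓝 0) ∧ Tendsto v atTop (𝓝 0) := by
  suffices h : Tendsto (fun t => (α * x t + (1 - α) * D * z t, v t)) atTop (𝓝 (0, 0)) from
    Prod.tendsto_iff _ _ |>.1 h
  rw [tendsto_iff_ultrafilter]
  intro U hU
  let F : ℝ × ℝ × ℝ → ℝ × ℝ × ℝ := fun p =>
    (p.2.2, D⁻¹ * A * p.2.2 - D⁻¹ * β * |p.2.1| ^ (n - 1) * p.2.1 * |p.2.2| -
        D⁻¹ * γ * |p.2.1| ^ n * p.2.2,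
      -(α * (k / m) * p.1) - (1 - α) * D * (k / m) * p.2.1 - (b / m) * p.2.2)
  have hF : Continuous F := by
    have h1 : Continuous fun p : ℝ × ℝ × ℝ => |p.2.1| ^ (n - 1) :=
      (by fun_prop : Continuous fun p : ℝ × ℝ × ℝ => |p.2.1|).rpow_const
        fun _ => Or.inr (by linarith)
    have h2 : Continuous fun p : ℝ × ℝ × ℝ => |p.2.1| ^ n :=
      (by fun_prop : Continuous fun p : ℝ × ℝ × ℝ => |p.2.1|).rpow_const
        fun _ => Or.inr (by linarith)
    fun_prop
  obtain ⟨Y, hY, hY'⟩ := exists_hasDerivAt_ultrafilter_limit (F := F)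
    (y := fun t => (x t, z t, v t)) (K := Icc (-R) R ×ˢ Icc (-R) R ×ˢ Icc (-R) R)
    (isCompact_Icc.prod (isCompact_Icc.prod isCompact_Icc)) hF.continuousOn
    (fun t ht => ⟨abs_le.1 (hR t ht).1, abs_le.1 (hR t ht).2.1, abs_le.1 (hR t ht).2.2⟩)
    (fun t ht => (hx t ht).prodMk ((hz t ht).prodMk (hv t ht))) U hU
  have hX' : ∀ s, HasDerivAt (fun s => (Y s).1) (Y s).2.2 s := fun s =>
    (ContinuousLinearMap.fst ℝ ℝ (ℝ × ℝ)).hasFDerivAt.comp_hasDerivAt s (hY' s)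
  have hZV' : ∀ s, HasDerivAt (fun s => (Y s).2) (F (Y s)).2 s := fun s =>
    (ContinuousLinearMap.snd ℝ ℝ (ℝ × ℝ)).hasFDerivAt.comp_hasDerivAt s (hY' s)
  have hZ' : ∀ s, HasDerivAt (fun s => (Y s).2.1) (F (Y s)).2.1 s := fun s =>
    (ContinuousLinearMap.fst ℝ ℝ ℝ).hasFDerivAt.comp_hasDerivAt s (hZV' s)
  have hV' : ∀ s, HasDerivAt (fun s => (Y s).2.2) (F (Y s)).2.2 s := fun s =>
    (ContinuousLinearMap.snd ℝ ℝ ℝ).hasFDerivAt.comp_hasDerivAt s (hZV' s)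
  have hconst : ∀ s, m / 2 * (Y s).2.2 ^ 2 + α * k / 2 * (Y s).1 ^ 2 +
        (1 - α) * D ^ 2 * k / (2 * A) * (Y s).2.1 ^ 2 = L := fun s => by
    have hc : Continuous fun p : ℝ × ℝ × ℝ => m / 2 * p.2.2 ^ 2 + α * k / 2 * p.1 ^ 2 +
        (1 - α) * D ^ 2 * k / (2 * A) * p.2.1 ^ 2 := by fun_prop
    exact tendsto_nhds_unique ((hc.tendsto _).comp (hY s).2)
      (hL.comp ((tendsto_atTop_add_const_right _ s tendsto_id).mono_left hU))
  have hdiss : ∀ s, b * (Y s).2.2 ^ 2 + (1 - α) * D * k / A * ((Y s).2.1 *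
      (β * |(Y s).2.1| ^ (n - 1) * (Y s).2.1 * |(Y s).2.2| +
        γ * |(Y s).2.1| ^ n * (Y s).2.2)) = 0 := fun s => by
    have h1 := boucWen_hasDerivWithinAt_energy (S := univ) (D := D) (x := fun s => (Y s).1)
      (z := fun s => (Y s).2.1) (v := fun s => (Y s).2.2) hm hA
      (hX' s).hasDerivWithinAt (hZ' s).hasDerivWithinAt (hV' s).hasDerivWithinAt
    have h2 := (hasDerivWithinAt_univ.1 h1).unique
      ((hasDerivAt_const s L).congr_of_eventuallyEq (.of_forall hconst))
    exact neg_eq_zero.1 h2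
  have hc0 : 0 < (1 - α) * D * k / A := by
    have := sub_pos.2 hα.2
    positivity
  have hsplit := fun s => (add_eq_zero_iff_of_nonneg (mul_nonneg hb (sq_nonneg (Y s).2.2))
    (mul_nonneg hc0.le (mul_hysteresis_nonneg hγ hn (Y s).2.1 (Y s).2.2))).1 (hdiss s)
  obtain ⟨h1, h2⟩ := boucWen_eq_zero_of_no_dissipation (b := b) hm hk hD hα hn hA hγ hX' hZ' hV'
    (fun s => by simpa using (hsplit s).1)
    (fun s => (mul_eq_zero.1 (hsplit s).2).resolve_left hc0.ne')
  have hc : Continuous fun p : ℝ × ℝ × ℝ => (α * p.1 + (1 - α) * D * p.2.1, p.2.2) := by fun_prop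
  have := (hc.tendsto _).comp (hY 0).2
  simpa only [Function.comp_def, add_zero, h1, h2] using this

/-- Every global solution of the Bouc-Wen oscillator of class I converges:
`x(t) → x_∞`, `z(t) → z_∞`, `v(t) → 0`, with `α x_∞ + (1 − α) D z_∞ = 0`. -/
theorem boucWen_classI_convergence
    (m k D A β γ b n α : ℝ)
    (hm : 0 < m) (hk : 0 < k) (hD : 0 < D)
    (hα : α ∈ Set.Ioo (0:ℝ) 1) (hn : 1 < n)
    (hA : 0 < A) (hγ : γ ∈ Set.Ioc (-β) β) (hb : 0 ≤ b)
    (x z v : ℝ → ℝ)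
    (hx : ∀ t ∈ Set.Ici (0:ℝ), HasDerivWithinAt x (v t) (Set.Ici 0) t)
    (hz : ∀ t ∈ Set.Ici (0:ℝ), HasDerivWithinAt z
      (D⁻¹ * A * v t - D⁻¹ * β * |z t| ^ (n - 1) * z t * |v t| -
        D⁻¹ * γ * |z t| ^ n * v t) (Set.Ici 0) t)
    (hv : ∀ t ∈ Set.Ici (0:ℝ), HasDerivWithinAt v
      (-(α * (k / m) * x t) - (1 - α) * D * (k / m) * z t - (b / m) * v t)
      (Set.Ici 0) t) :
    ∃ x_inf z_inf : ℝ,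
      Filter.Tendsto x Filter.atTop (nhds x_inf) ∧
      Filter.Tendsto z Filter.atTop (nhds z_inf) ∧
      Filter.Tendsto v Filter.atTop (nhds 0) ∧
      α * x_inf + (1 - α) * D * z_inf = 0 := by
  have hα0 := hα.1
  have hα1 := sub_pos.2 hα.2
  set V : ℝ → ℝ := fun t => m / 2 * v t ^ 2 + α * k / 2 * x t ^ 2 +
    (1 - α) * D ^ 2 * k / (2 * A) * z t ^ 2 with hV_def
  have hV' := fun t (ht : t ∈ Ici (0 : ℝ)) =>
    boucWen_hasDerivWithinAt_energy hm hA (hx t ht) (hz t ht) (hv t ht)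
  have hV0 : ∀ t, 0 ≤ V t := fun t => by positivity
  have hanti : AntitoneOn V (Ici 0) := by
    refine antitoneOn_of_hasDerivWithinAt_nonpos (convex_Ici 0)
      (fun t ht => (hV' t ht).continuousWithinAt)
      (fun t ht => (hV' t (interior_subset ht)).mono interior_subset) fun t _ => ?_
    have := mul_hysteresis_nonneg hγ hn (z t) (v t)
    rw [neg_nonpos]
    positivity
  obtain ⟨L, hL⟩ : ∃ L, Tendsto V atTop (𝓝 L) := by
    have hW : Antitone fun t => V (max t 0) := fun s t hst =>
      hanti (le_max_right s 0) (le_max_right t 0) (max_le_max_right 0 hst)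
    refine ⟨_, (tendsto_atTop_ciInf hW ⟨0, ?_⟩).congr' ?_⟩
    · rintro _ ⟨t, rfl⟩
      exact hV0 _
    · filter_upwards [eventually_ge_atTop 0] with t ht
      rw [max_eq_left ht]
  have hbound : ∀ c : ℝ, 0 < c → ∀ r t : ℝ, t ∈ Ici (0 : ℝ) → c * r ^ 2 ≤ V t →
      |r| ≤ √(V 0 / c) := fun c hc r t ht h => by
    refine Real.abs_le_sqrt ((le_div_iff₀ hc).2 ?_)
    rw [mul_comm]
    exact h.trans (hanti self_mem_Ici ht ht)
  have hcx : 0 < α * k / 2 := by positivity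
  have hcz : 0 < (1 - α) * D ^ 2 * k / (2 * A) := by positivity
  have hterms : ∀ t, 0 ≤ m / 2 * v t ^ 2 ∧ 0 ≤ α * k / 2 * x t ^ 2 ∧
      0 ≤ (1 - α) * D ^ 2 * k / (2 * A) * z t ^ 2 := fun t =>
    ⟨by positivity, by positivity, by positivity⟩
  obtain ⟨hw, hv0⟩ := boucWen_tendsto_of_energy hm hk hD hα hn hA hγ hb hx hz hv
    (R := max √(V 0 / (α * k / 2)) (max √(V 0 / ((1 - α) * D ^ 2 * k / (2 * A))) √(V 0 / (m / 2))))
    (fun t ht => by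
      obtain ⟨h1, h2, h3⟩ := hterms t
      exact ⟨le_max_of_le_left (hbound _ hcx _ t ht (by simp only [hV_def]; linarith)),
        le_max_of_le_right (le_max_of_le_left
          (hbound _ hcz _ t ht (by simp only [hV_def]; linarith))),
        le_max_of_le_right (le_max_of_le_right
          (hbound _ (half_pos hm) _ t ht (by simp only [hV_def]; linarith)))⟩) hL
  -- `q` is the position term of the energy at an equilibrium, where `z = p * x`.
  set p := -(α / ((1 - α) * D)) with hp
  set q := α * k / 2 + (1 - α) * D ^ 2 * k / (2 * A) * p ^ 2 with hq
  have hq0 : 0 < q := by positivity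
  have hr : Tendsto (fun t => z t - p * x t) atTop (𝓝 0) := by
    have := hw.const_mul (1 / ((1 - α) * D))
    rw [mul_zero] at this
    refine this.congr fun t => ?_
    rw [hp]
    field_simp
    ring
  have hzb : ∀ t ∈ Ici (0 : ℝ), |z t + p * x t| ≤
      √(V 0 / ((1 - α) * D ^ 2 * k / (2 * A))) + |p| * √(V 0 / (α * k / 2)) := fun t ht => by
    obtain ⟨h1, h2, h3⟩ := hterms t
    refine (abs_add_le _ _).trans (add_le_add
      (hbound _ hcz _ t ht (by simp only [hV_def]; linarith)) ?_)
    rw [abs_mul]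
    gcongr
    exact hbound _ hcx _ t ht (by simp only [hV_def]; linarith)
  have hprod : Tendsto (fun t => (z t - p * x t) * (z t + p * x t)) atTop (𝓝 0) :=
    hr.zero_mul_isBoundedUnder_le
      (isBoundedUnder_of_eventually_le ((eventually_ge_atTop 0).mono hzb))
  have hxsq : Tendsto (fun t => x t ^ 2) atTop (𝓝 (L / q)) := by
    have h1 := ((hL.sub ((hv0.pow 2).const_mul (m / 2))).sub
      (hprod.const_mul ((1 - α) * D ^ 2 * k / (2 * A)))).div_const q
    simp only [ne_eq, OfNat.ofNat_ne_zero, not_false_eq_true, zero_pow, mul_zero, sub_zero] at h1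
    refine h1.congr fun t => ?_
    rw [div_eq_iff hq0.ne']
    simp only [hV_def, hq]
    ring
  obtain ⟨X, hX⟩ := exists_tendsto_of_tendsto_sq (fun t ht => (hx t ht).continuousWithinAt) hxsq
  refine ⟨X, p * X, hX, ?_, hv0, ?_⟩
  · simpa using hr.add (hX.const_mul p)
  · rw [hp]
    field_simp
    ring
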